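/- If either of the following conditions holds, then the classes C_f and C_h of skew polycyclic codes of length m over S are not equivalent: (i) τ(a_{m-1}) ≠ σ^{m-1}(α)·b_{m-1} for all units α of S and all τ ∈ Aut(S) commuting with σ; or (ii) there exists i ∈ {0, …, m−1} such that a_i and b_i are invertible and N_{S/S_0}(τ(a_i)·b_i^{-1}) does not lie in the subgroup (N_{S/S_0}(S^×))^{m-i} of m−i-th powers of norms, for every τ ∈ Aut(S) commuting with σ. -/

import Mathlib

/-- `Nsig σ i β = ∏_{j=0}^{i-1} σ^j(β)`. -/
def Nsig {S : Type*} [CommRing S] (σ : S ≃+* S) (i : ℕ) (β : S) : S :=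
  ∏ j ∈ Finset.range i, (σ ^ j) β

/-- The coefficient vector of the monomial `c·t^k` in `S^m`. -/
def stdVec {S : Type*} [Ring S] (m k : ℕ) (c : S) : Fin m → S :=
  fun j => if (j : ℕ) = k then c else 0

/-- Left multiplication by `t`, followed by reduction modulo `f = t^m − ∑ a_i t^i`,
on coefficient vectors representing elements of the Petit algebra `S[t;σ]/S[t;σ]f`. -/
def tmul {S : Type*} [Ring S] (σ : S ≃+* S) {m : ℕ} (a : Fin m → S)
    (c : Fin m → S) : Fin m → S :=
  fun j =>
    (if _ : (j : ℕ) = 0 then 0 else σ (c ⟨(j : ℕ) - 1, by have := j.isLt; omega⟩)) +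
      σ (c ⟨m - 1, by have := j.isLt; omega⟩) * a j

/-- The multiplication of the Petit algebra `S[t;σ]/S[t;σ]f`, `f = t^m − ∑ a_i t^i`:
`g ∘ h` is the remainder of the skew-polynomial product `g·h` under right division by `f`. -/
def petitMul {S : Type*} [Ring S] (σ : S ≃+* S) {m : ℕ} (a : Fin m → S)
    (g h : Fin m → S) : Fin m → S :=
  fun j => ∑ i : Fin m, g i * (tmul σ a)^[(i : ℕ)] h j

/-- The map `G_{τ,α} : ∑ d_i t^i ↦ ∑ τ(d_i) N_i^σ(α) t^i` on coefficient vectors. -/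
def Gmap {S : Type*} [CommRing S] (σ τ : S ≃+* S) (α : S) {m : ℕ}
    (d : Fin m → S) : Fin m → S :=
  fun i => τ (d i) * Nsig σ (i : ℕ) α

/-- `G` is an isomorphism from the Petit algebra `S[t;σ]/S[t;σ](t^m − ∑ a_i t^i)` to the
Petit algebra `S[t;σ]/S[t;σ](t^m − ∑ b_i t^i)`: a bijective, additive, unital and
multiplicative map on coefficient vectors. -/
def IsPetitIso {S : Type*} [Ring S] (σ : S ≃+* S) {m : ℕ} (a b : Fin m → S)
    (G : (Fin m → S) → (Fin m → S)) : Prop :=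
  Function.Bijective G ∧ (∀ x y, G (x + y) = G x + G y) ∧
    G (stdVec m 0 1) = stdVec m 0 1 ∧
    (∀ x y, G (petitMul σ a x y) = petitMul σ b (G x) (G y))

section Nsig

variable {S : Type*} [CommRing S] (σ : S ≃+* S)

theorem Nsig_succ (i : ℕ) (x : S) : Nsig σ (i + 1) x = Nsig σ i x * (σ ^ i) x :=
  Finset.prod_range_succ _ _

theorem Nsig_one_left (x : S) : Nsig σ 1 x = x := by
  simp [Nsig]

theorem Nsig_mul (i : ℕ) (x y : S) : Nsig σ i (x * y) = Nsig σ i x * Nsig σ i y := by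
  simp [Nsig, Finset.prod_mul_distrib]

theorem Nsig_one (i : ℕ) : Nsig σ i 1 = 1 := by
  simp [Nsig]

theorem Nsig_add (i k : ℕ) (x : S) :
    Nsig σ (i + k) x = Nsig σ i x * (σ ^ i) (Nsig σ k x) := by
  simp only [Nsig, Finset.prod_range_add, map_prod, pow_add, RingAut.mul_apply]

theorem IsUnit.Nsig {x : S} (hx : IsUnit x) (i : ℕ) : IsUnit (Nsig σ i x) := by
  induction i with
  | zero => simp [_root_.Nsig]
  | succ i ih =>
    rw [Nsig_succ]
    exact ih.mul (hx.map (σ ^ i))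

theorem Nsig_apply_of_pow_eq_one {n : ℕ} (hσ : σ ^ n = 1) (x : S) :
    Nsig σ n (σ x) = Nsig σ n x := by
  have hstep : ∀ j, (σ ^ j) (σ x) = (σ ^ (j + 1)) x := fun j => by
    rw [pow_succ, RingAut.mul_apply]
  rcases n with _ | n
  · simp [Nsig]
  · simp only [Nsig, hstep]
    rw [Finset.prod_range_succ, Finset.prod_range_succ', hσ, pow_zero]

theorem Nsig_pow_apply_of_pow_eq_one {n : ℕ} (hσ : σ ^ n = 1) (i : ℕ) (x : S) :
    Nsig σ n ((σ ^ i) x) = Nsig σ n x := by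
  induction i with
  | zero => simp
  | succ i ih => rw [pow_succ', RingAut.mul_apply, Nsig_apply_of_pow_eq_one σ hσ, ih]

theorem Nsig_Nsig_of_pow_eq_one {n : ℕ} (hσ : σ ^ n = 1) (k : ℕ) (x : S) :
    Nsig σ n (Nsig σ k x) = Nsig σ n x ^ k := by
  induction k with
  | zero => rw [pow_zero]; exact Nsig_one σ n
  | succ k ih =>
    rw [Nsig_succ, Nsig_mul, ih, Nsig_pow_apply_of_pow_eq_one σ hσ, pow_succ]

end Nsig

section Petit

variable {S : Type*} [CommRing S] (σ : S ≃+* S) {m : ℕ}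

/-- In the Petit algebra, `(c·t) ∘ (d·t^(m-1)) = c σ(d) t^m`, reduced modulo `f`. -/
theorem petitMul_stdVec_one_stdVec_pred (hm : 1 < m) (a : Fin m → S) (c d : S) (j : Fin m) :
    petitMul σ a (stdVec m 1 c) (stdVec m (m - 1) d) j = c * (σ d * a j) := by
  rw [petitMul, Finset.sum_eq_single ⟨1, hm⟩]
  · have hj : (j : ℕ) - 1 ≠ m - 1 ∨ (j : ℕ) = 0 := by omega
    rcases hj with hj | hj <;> simp [stdVec, tmul, hj]
  · intro i _ hi
    have : (i : ℕ) ≠ 1 := fun h => hi (Fin.ext h)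
    simp [stdVec, this]
  · simp

theorem Gmap_stdVec (τ : S ≃+* S) (α : S) (k : ℕ) (c : S) :
    Gmap σ τ α (stdVec m k c) = stdVec m k (τ c * Nsig σ k α) := by
  ext j
  by_cases h : (j : ℕ) = k <;> simp [Gmap, stdVec, h]

/-- A multiplicative `G_{τ,α}` forces `τ(a_i) = σ^i(N_{m-i}(α)) b_i`. -/
theorem IsPetitIso.map_coeff {a b : Fin m → S} {τ : S ≃+* S} {α : S} (hm : 1 < m)
    (hα : IsUnit α) (h : IsPetitIso σ a b (Gmap σ τ α)) (i : Fin m) :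
    τ (a i) = (σ ^ (i : ℕ)) (Nsig σ (m - i) α) * b i := by
  have hmul := congrFun (h.2.2.2 (stdVec m 1 1) (stdVec m (m - 1) 1)) i
  rw [Gmap_stdVec, Gmap_stdVec, petitMul_stdVec_one_stdVec_pred σ hm, Gmap,
    petitMul_stdVec_one_stdVec_pred σ hm, Nsig_one_left] at hmul
  have h₁ := Nsig_add σ 1 (m - 1) α
  have h₂ := Nsig_add σ i (m - i) α
  rw [Nsig_one_left, pow_one, show 1 + (m - 1) = m by omega] at h₁
  rw [show (i : ℕ) + (m - i) = m by omega, h₁] at h₂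
  simp only [map_one, one_mul] at hmul
  refine (hα.Nsig σ i).mul_left_cancel ?_
  linear_combination hmul + b i * h₂

end Petit

/-- **Corollary (conditions for non-equivalence).**  If (i) `τ(a_{m-1}) ≠ σ^{m-1}(α)·b_{m-1}`
for all `α ∈ S^×` and all `τ ∈ Aut(S)` commuting with `σ`, or (ii) there exists `i` with
`a_i, b_i` invertible and `N_{S/S₀}(τ(a_i)·b_i^{-1}) ∉ (N_{S/S₀}(S^×))^{m-i}` for every
`τ ∈ Aut(S)` commuting with `σ`, then the classes `C_f` and `C_h` are not equivalent. -/
theorem stmt15 {S : Type*} [CommRing S] (σ : S ≃+* S) (n : ℕ) (hn : 0 < n)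
    (hord : orderOf σ = n) (m : ℕ) (hm : 1 < m) (a b : Fin m → S)
    (hcond :
      (∀ α : S, IsUnit α → ∀ τ : S ≃+* S, σ * τ = τ * σ →
        τ (a ⟨m - 1, by omega⟩) ≠ (σ ^ (m - 1)) α * b ⟨m - 1, by omega⟩) ∨
      (∃ i : Fin m, IsUnit (a i) ∧ IsUnit (b i) ∧
        ∀ τ : S ≃+* S, σ * τ = τ * σ → ∀ c : S, b i * c = 1 →
          ¬ ∃ y : S, IsUnit y ∧ (Nsig σ n y) ^ (m - (i : ℕ)) = Nsig σ n (τ (a i) * c))) :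
    ¬ ∃ τ : S ≃+* S, σ * τ = τ * σ ∧ ∃ α : S, IsUnit α ∧
      IsPetitIso σ a b (Gmap σ τ α) := by
  rintro ⟨τ, hτ, α, hα, hiso⟩
  have hcoeff := hiso.map_coeff σ hm hα
  rcases hcond with h | ⟨i, -, hb, h⟩
  · refine h α hα τ hτ ?_
    rw [hcoeff]
    simp only [show m - (m - 1) = 1 by omega, Nsig_one_left]
  · have hσ : σ ^ n = 1 := hord ▸ pow_orderOf_eq_one σ
    obtain ⟨c, hc⟩ : ∃ c, b i * c = 1 := hb.exists_right_inv
    refine h τ hτ c hc ⟨α, hα, ?_⟩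
    rw [hcoeff, mul_assoc, hc, mul_one, Nsig_pow_apply_of_pow_eq_one σ hσ,
      Nsig_Nsig_of_pow_eq_one σ hσ]
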